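/- Let K = ℂ(t) be the field of rational functions in one variable t over ℂ. There do not exist x, y, z, w ∈ K, not all zero, satisfying x² − y² = t(z² − w²) and t(x² + y²) = z² + w². -/

import Mathlib

open Polynomial

/-- `f` has degree at most `n`, and `a` is its coefficient in degree `n`. -/
structure HasTopCoeff (f : ℂ[X]) (n : ℕ) (a : ℂ) : Prop where
  natDegree_le : f.natDegree ≤ n
  coeff_eq : f.coeff n = a

namespace HasTopCoeff

variable {f g : ℂ[X]} {m n : ℕ} {a b : ℂ}

theorem mul (hf : HasTopCoeff f m a) (hg : HasTopCoeff g n b) :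
    HasTopCoeff (f * g) (m + n) (a * b) where
  natDegree_le := natDegree_mul_le_of_le hf.1 hg.1
  coeff_eq := by rw [coeff_mul_add_eq_of_natDegree_le hf.1 hg.1, hf.2, hg.2]

theorem add (hf : HasTopCoeff f n a) (hg : HasTopCoeff g n b) :
    HasTopCoeff (f + g) n (a + b) where
  natDegree_le := natDegree_add_le_of_degree_le hf.1 hg.1
  coeff_eq := by rw [coeff_add, hf.2, hg.2]

theorem sub (hf : HasTopCoeff f n a) (hg : HasTopCoeff g n b) :
    HasTopCoeff (f - g) n (a - b) where
  natDegree_le := natDegree_sub_le_of_le hf.1 hg.1 |>.trans (max_self n).le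
  coeff_eq := by rw [coeff_sub, hf.2, hg.2]

theorem C_mul (hf : HasTopCoeff f n a) (k : ℂ) : HasTopCoeff (C k * f) n (k * a) where
  natDegree_le := (natDegree_C_mul_le k f).trans hf.1
  coeff_eq := by rw [coeff_C_mul, hf.2]

theorem sq (hf : HasTopCoeff f n a) : HasTopCoeff (f ^ 2) (n + n) (a ^ 2) := by
  rw [pow_two, pow_two]
  exact hf.mul hf

theorem X_mul (hf : HasTopCoeff f n a) : HasTopCoeff (X * f) (n + 1) a where
  natDegree_le := by
    rw [add_comm n 1]
    exact natDegree_mul_le_of_le natDegree_X_le hf.1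
  coeff_eq := by rw [coeff_X_mul, hf.2]

theorem X_mul_derivative (hf : HasTopCoeff f n a) :
    HasTopCoeff (X * derivative f) n (n * a) where
  natDegree_le := by
    rcases n with _ | n
    · rw [derivative_of_natDegree_zero (Nat.le_zero.mp hf.1)]
      simp
    · rw [add_comm n 1]
      exact natDegree_mul_le_of_le natDegree_X_le
        ((natDegree_derivative_le f).trans (Nat.sub_le_of_le_add hf.1))
  coeff_eq := by
    rcases n with _ | n
    · simp
    · rw [coeff_X_mul, coeff_derivative, hf.2]
      push_cast
      ring

theorem succ_of_le (hf : f.natDegree ≤ n) : HasTopCoeff f (n + 1) 0 :=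
  ⟨by lia, coeff_eq_zero_of_natDegree_lt (by lia)⟩

theorem unique (hf : HasTopCoeff f n a) (hg : HasTopCoeff f n b) : a = b :=
  hf.2.symm.trans hg.2

theorem natDegree_le_of_zero (hf : HasTopCoeff f (n + 1) 0) : f.natDegree ≤ n :=
  natDegree_le_pred hf.1 hf.2

theorem eq_zero (hf : HasTopCoeff f 0 0) : f = 0 := by
  rw [eq_C_of_natDegree_le_zero hf.1, hf.2, C_0]

/-- Dividing by a polynomial whose coefficient in the bounding degree is nonzero. -/
theorem exists_of_mul (hf : HasTopCoeff f m a) (ha : a ≠ 0) (hfg : HasTopCoeff (f * g) (m + n) b) :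
    ∃ c, HasTopCoeff g n c ∧ a * c = b := by
  have hf0 : f ≠ 0 := by
    rintro rfl
    exact ha (by simpa using hf.2.symm)
  have hdeg : f.natDegree = m :=
    le_antisymm hf.1 (le_natDegree_of_ne_zero (by rwa [hf.2]))
  have hg : g.natDegree ≤ n := by
    by_cases hg0 : g = 0
    · simp [hg0]
    · have := hfg.1
      rw [natDegree_mul hf0 hg0] at this
      lia
  exact ⟨g.coeff n, ⟨hg, rfl⟩, (hf.mul ⟨hg, rfl⟩).unique hfg⟩

end HasTopCoeff

/-- A polynomial solution of the equations of `C` without common zero. -/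
structure IsPolynomialPoint (x y z w : ℂ[X]) : Prop where
  sub_eq : x ^ 2 - y ^ 2 = X * (z ^ 2 - w ^ 2)
  add_eq : X * (x ^ 2 + y ^ 2) = z ^ 2 + w ^ 2
  no_common_zero : ∀ e, ¬ (x.eval e = 0 ∧ y.eval e = 0 ∧ z.eval e = 0 ∧ w.eval e = 0)

namespace IsPolynomialPoint

/-- A nonzero polynomial solution can be divided by the greatest common divisor of its
coordinates. -/
theorem exists_of_ne_zero {x y z w : ℂ[X]} (h0 : x ≠ 0 ∨ y ≠ 0 ∨ z ≠ 0 ∨ w ≠ 0)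
    (h1 : x ^ 2 - y ^ 2 = X * (z ^ 2 - w ^ 2)) (h2 : X * (x ^ 2 + y ^ 2) = z ^ 2 + w ^ 2) :
    ∃ x y z w, IsPolynomialPoint x y z w := by
  obtain ⟨g, hg⟩ := IsPrincipalIdealRing.principal (Ideal.span {x, y, z, w})
  rw [Ideal.submodule_span_eq] at hg
  have hdvd : ∀ f ∈ ({x, y, z, w} : Set ℂ[X]), g ∣ f := fun f hf =>
    Ideal.mem_span_singleton.mp (hg ▸ Ideal.subset_span hf)
  obtain ⟨x, rfl⟩ := hdvd x (by simp)
  obtain ⟨y, rfl⟩ := hdvd y (by simp)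
  obtain ⟨z, rfl⟩ := hdvd z (by simp)
  obtain ⟨w, rfl⟩ := hdvd w (by simp)
  have hg0 : g ≠ 0 := by
    rintro rfl
    simp at h0
  have hmem : g ∈ Ideal.span {g * x, g * y, g * z, g * w} := by
    rw [hg]
    exact Ideal.mem_span_singleton_self g
  simp only [Ideal.mem_span_insert, Ideal.mem_span_singleton'] at hmem
  obtain ⟨a, _, ⟨b, _, ⟨c, _, ⟨d, rfl⟩, rfl⟩, rfl⟩, hbez⟩ := hmem
  have hbez' : a * x + b * y + c * z + d * w = 1 :=
    mul_left_cancel₀ hg0 (by linear_combination -hbez)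
  refine ⟨x, y, z, w, mul_left_cancel₀ (pow_ne_zero 2 hg0) (by linear_combination h1),
    mul_left_cancel₀ (pow_ne_zero 2 hg0) (by linear_combination h2), ?_⟩
  rintro e ⟨hx, hy, hz, hw⟩
  simpa [hx, hy, hz, hw] using congrArg (eval e) hbez'

variable {x y z w : ℂ[X]}

theorem swap (h : IsPolynomialPoint x y z w) : IsPolynomialPoint y x w z where
  sub_eq := by linear_combination -h.sub_eq
  add_eq := by linear_combination h.add_eq
  no_common_zero e := fun ⟨hy, hx, hw, hz⟩ => h.no_common_zero e ⟨hx, hy, hz, hw⟩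

theorem derivative_sub_eq (h : IsPolynomialPoint x y z w) :
    2 * x * derivative x - 2 * y * derivative y =
      z ^ 2 - w ^ 2 + X * (2 * z * derivative z - 2 * w * derivative w) := by
  have := congrArg derivative h.sub_eq
  simp only [derivative_sub, derivative_mul, derivative_X, derivative_sq, map_ofNat] at this
  linear_combination this

theorem derivative_add_eq (h : IsPolynomialPoint x y z w) :
    x ^ 2 + y ^ 2 + X * (2 * x * derivative x + 2 * y * derivative y) =
      2 * z * derivative z + 2 * w * derivative w := by
  have := congrArg derivative h.add_eq
  simp only [derivative_add, derivative_mul, derivative_X, derivative_sq, map_ofNat] at this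
  linear_combination this

theorem eval_sub_eq (h : IsPolynomialPoint x y z w) (e : ℂ) :
    x.eval e ^ 2 - y.eval e ^ 2 = e * (z.eval e ^ 2 - w.eval e ^ 2) := by
  simpa using congrArg (eval e) h.sub_eq

theorem eval_add_eq (h : IsPolynomialPoint x y z w) (e : ℂ) :
    e * (x.eval e ^ 2 + y.eval e ^ 2) = z.eval e ^ 2 + w.eval e ^ 2 := by
  simpa using congrArg (eval e) h.add_eq

/-- At `t = 0` the point avoids the coordinate planes. -/
theorem eval_zero_ne_zero (h : IsPolynomialPoint x y z w) :
    x.eval 0 ≠ 0 ∧ z.eval 0 ≠ 0 := by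
  have h1 := h.eval_sub_eq 0
  have h2 := h.eval_add_eq 0
  have h3 := congrArg (eval 0) h.derivative_sub_eq
  have h4 := congrArg (eval 0) h.derivative_add_eq
  have h0 := h.no_common_zero 0
  simp only [eval_add, eval_sub, eval_mul, eval_pow, eval_X, eval_ofNat] at h3 h4
  constructor
  · intro hx
    have hy : y.eval 0 = 0 := by simpa [hx] using h1
    rw [hx, hy] at h2 h3
    exact h0 ⟨hx, hy, sq_eq_zero_iff.mp (by linear_combination -(h2 + h3) / 2),
      sq_eq_zero_iff.mp (by linear_combination (h3 - h2) / 2)⟩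
  · intro hz
    have hw : w.eval 0 = 0 := by simpa [hz] using h2.symm
    rw [hz, hw] at h1 h4
    exact h0 ⟨sq_eq_zero_iff.mp (by linear_combination (h1 + h4) / 2),
      sq_eq_zero_iff.mp (by linear_combination (h4 - h1) / 2), hz, hw⟩

theorem eval_root_of_unity_ne_zero (h : IsPolynomialPoint x y z w) {e : ℂ} (he : e ^ 4 = 1) :
    x.eval e ≠ 0 := by
  have h1 := h.eval_sub_eq e
  have h2 := h.eval_add_eq e
  have h3 := congrArg (eval e) h.derivative_sub_eq
  have h4 := congrArg (eval e) h.derivative_add_eq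
  have h0 := h.no_common_zero e
  simp only [eval_add, eval_sub, eval_mul, eval_pow, eval_X, eval_ofNat] at h3 h4
  intro hx
  rw [hx] at h1 h2 h3 h4
  have hsq : (e ^ 2 - 1) * (e ^ 2 + 1) = 0 := by linear_combination he
  rcases mul_eq_zero.mp hsq with he' | he'
  · have hz : z.eval e = 0 := sq_eq_zero_iff.mp (by
      linear_combination (-e * h1 - h2 - (z.eval e ^ 2 - w.eval e ^ 2) * he') / 2)
    rw [hz] at h1 h2 h3 h4
    have hy : y.eval e = 0 := sq_eq_zero_iff.mp (by
      linear_combination (e * h3 + h4 - h1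
        - 2 * w.eval e * (derivative w).eval e * he') / 2)
    exact h0 ⟨hx, hy, hz, sq_eq_zero_iff.mp (by simpa [hy] using h2.symm)⟩
  · have hw : w.eval e = 0 := sq_eq_zero_iff.mp (by
      linear_combination (-e * h1 - h2 - (z.eval e ^ 2 - w.eval e ^ 2) * he') / 2)
    rw [hw] at h1 h2 h3 h4
    have hy : y.eval e = 0 := sq_eq_zero_iff.mp (by
      linear_combination (e * h3 + h4 - h1
        + 2 * z.eval e * (derivative z).eval e * he') / 2)
    exact h0 ⟨hx, hy, sq_eq_zero_iff.mp (by simpa [hy] using h2.symm), hw⟩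

theorem eval_root_of_unity_sq_mul_sq (h : IsPolynomialPoint x y z w) {e : ℂ} (he : e ^ 4 = 1) :
    z.eval e ^ 2 * w.eval e ^ 2 = e ^ 2 * x.eval e ^ 2 * y.eval e ^ 2 := by
  have h1 := h.eval_sub_eq e
  have h2 := h.eval_add_eq e
  have hsq : (e ^ 2 - 1) * (e ^ 2 + 1) = 0 := by linear_combination he
  rcases mul_eq_zero.mp hsq with he' | he'
  · have hz : z.eval e ^ 2 = e * x.eval e ^ 2 := by
      linear_combination (-e * h1 - h2 - (z.eval e ^ 2 - w.eval e ^ 2) * he') / 2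
    have hw : w.eval e ^ 2 = e * y.eval e ^ 2 := by linear_combination -h2 - hz
    rw [hz, hw]
    ring
  · have hw : w.eval e ^ 2 = e * x.eval e ^ 2 := by
      linear_combination (-e * h1 - h2 - (z.eval e ^ 2 - w.eval e ^ 2) * he') / 2
    have hz : z.eval e ^ 2 = e * y.eval e ^ 2 := by linear_combination -h2 - hw
    rw [hz, hw]
    ring

theorem isCoprime_left (h : IsPolynomialPoint x y z w) : IsCoprime x y := by
  rw [isCoprime_iff_aeval_ne_zero_of_isAlgClosed ℂ ℂ]
  intro e
  by_contra! hxy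
  simp only [coe_aeval_eq_eval] at hxy
  have h1 := h.eval_sub_eq e
  have h2 := h.eval_add_eq e
  have he0 : e ≠ 0 := by
    rintro rfl
    exact h.eval_zero_ne_zero.1 hxy.1
  rw [hxy.1, hxy.2] at h1 h2
  have hz : z.eval e = 0 := by
    have : e * z.eval e ^ 2 = 0 := by linear_combination (-h1 - e * h2) / 2
    simpa [he0] using this
  have hw : w.eval e = 0 := by
    simpa [hz] using h2.symm
  exact h.no_common_zero e ⟨hxy.1, hxy.2, hz, hw⟩

theorem isCoprime_middle (h : IsPolynomialPoint x y z w) : IsCoprime y z := by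
  rw [isCoprime_iff_aeval_ne_zero_of_isAlgClosed ℂ ℂ]
  intro e
  by_contra! hyz
  simp only [coe_aeval_eq_eval] at hyz
  have h1 := h.eval_sub_eq e
  have h2 := h.eval_add_eq e
  have he : e ^ 4 ≠ 1 := fun he => h.swap.eval_root_of_unity_ne_zero he hyz.1
  rw [hyz.1, hyz.2] at h1 h2
  have hw : w.eval e = 0 := by
    have : (1 + e ^ 2) * w.eval e ^ 2 = 0 := by linear_combination e * h1 - h2
    rcases mul_eq_zero.mp this with he' | hw
    · exact absurd (by linear_combination (e ^ 2 - 1) * he') he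
    · simpa using hw
  have hx : x.eval e = 0 := by simpa [hw] using h1
  exact h.no_common_zero e ⟨hx, hyz.1, hyz.2, hw⟩

/-- The slope of the point along the fibration, measured in the chart of the coordinate `x`. -/
theorem exists_slope (h : IsPolynomialPoint x y z w) : ∃ p : ℂ[X],
    y * p = (1 - X ^ 4) * (z * derivative w - derivative z * w) + 2 * X * z * w ∧
    z * p = 2 * X * (1 + X ^ 2) * (y * derivative w - derivative y * w) - (1 - X ^ 2) * y * w := by
  have key : z * ((1 - X ^ 4) * (z * derivative w - derivative z * w) + 2 * X * z * w) =
      y * (2 * X * (1 + X ^ 2) * (y * derivative w - derivative y * w) - (1 - X ^ 2) * y * w) := by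
    refine mul_left_cancel₀ (two_ne_zero' ℂ[X]) ?_
    linear_combination
      -(1 + X ^ 2) * (2 * derivative w * (h.add_eq - X * h.sub_eq)
        - w * (h.derivative_add_eq - X * h.derivative_sub_eq - h.sub_eq))
      - 2 * X * w * (h.add_eq - X * h.sub_eq)
  obtain ⟨p, hp⟩ : y ∣ (1 - X ^ 4) * (z * derivative w - derivative z * w) + 2 * X * z * w :=
    h.isCoprime_middle.dvd_of_dvd_mul_left (Dvd.intro _ key.symm)
  refine ⟨p, hp.symm, ?_⟩
  have hy : y ≠ 0 := by
    rintro rfl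
    exact h.swap.eval_root_of_unity_ne_zero (one_pow 4) eval_zero
  exact mul_left_cancel₀ hy (by linear_combination key - z * hp)

theorem wronskian_eq (h : IsPolynomialPoint x y z w) :
    2 * X * (x * y * (derivative x * y - x * derivative y)
      + z * w * (z * derivative w - derivative z * w)) = x ^ 4 - y ^ 4 := by
  refine mul_left_cancel₀ (two_ne_zero' ℂ[X]) ?_
  linear_combination X * (x ^ 2 + y ^ 2) * h.derivative_sub_eq
    + X * (2 * z * derivative z - 2 * w * derivative w) * h.add_eq
    - (x ^ 2 - y ^ 2) * h.derivative_add_eq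
    - (2 * z * derivative z + 2 * w * derivative w + x ^ 2 + y ^ 2) * h.sub_eq

/-- The connection polynomial: its quotient by `8 * (X ^ 5 - X)` is a logarithmic differential
on the `t`-line. -/
theorem exists_connection (h : IsPolynomialPoint x y z w) : ∃ p q : ℂ[X],
    y * p = (1 - X ^ 4) * (z * derivative w - derivative z * w) + 2 * X * z * w ∧
    z * p = 2 * X * (1 + X ^ 2) * (y * derivative w - derivative y * w) - (1 - X ^ 2) * y * w ∧
    x ^ 2 * q = (X ^ 4 - 1) * (8 * (x * (X * derivative x)) + 4 * y ^ 2) - p ^ 2 := by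
  obtain ⟨p, hp1, hp2⟩ := h.exists_slope
  obtain ⟨r, hr1, -⟩ := h.swap.exists_slope
  have key : y ^ 2 * ((X ^ 4 - 1) * (8 * (x * (X * derivative x)) + 4 * y ^ 2) - p ^ 2) =
      x ^ 2 * ((X ^ 4 - 1) * (8 * (y * (X * derivative y)) + 4 * x ^ 2) - r ^ 2) := by
    linear_combination
      -(y * p + (1 - X ^ 4) * (z * derivative w - derivative z * w) + 2 * X * z * w) * hp1
      + (x * r + (1 - X ^ 4) * (w * derivative z - derivative w * z) + 2 * X * w * z) * hr1
      + 4 * (X ^ 4 - 1) * h.wronskian_eq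
  obtain ⟨q, hq⟩ : x ^ 2 ∣ (X ^ 4 - 1) * (8 * (x * (X * derivative x)) + 4 * y ^ 2) - p ^ 2 :=
    h.isCoprime_left.pow.dvd_of_dvd_mul_left (Dvd.intro _ key.symm)
  exact ⟨p, q, hp1, hp2, hq.symm⟩

/-- At `t = ∞` the point avoids the coordinate planes. -/
theorem topCoeff_ne_zero (h : IsPolynomialPoint x y z w) {n : ℕ} {a b c d : ℂ}
    (hx : HasTopCoeff x n a) (hy : HasTopCoeff y n b) (hz : HasTopCoeff z n c)
    (hw : HasTopCoeff w n d) (h0 : ¬ (a = 0 ∧ b = 0 ∧ c = 0 ∧ d = 0)) :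
    (a ≠ 0 ∧ c ≠ 0) ∧ b ^ 2 = -a ^ 2 ∧ d ^ 2 = c ^ 2 := by
  have hcd : 0 = c ^ 2 - d ^ 2 :=
    (HasTopCoeff.succ_of_le (hx.sq.sub hy.sq).1).unique
      (h.sub_eq ▸ (hz.sq.sub hw.sq).X_mul)
  have hab : a ^ 2 + b ^ 2 = 0 :=
    (hx.sq.add hy.sq).X_mul.unique
      (h.add_eq ▸ HasTopCoeff.succ_of_le (hz.sq.add hw.sq).1)
  refine ⟨⟨?_, ?_⟩, by linear_combination hab, by linear_combination hcd⟩
  · rintro rfl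
    obtain rfl : b = 0 := by simpa using hab
    have hsum : c ^ 2 + d ^ 2 = 0 := by
      rcases n with _ | n
      · refine (h.add_eq ▸ hz.sq.add hw.sq).unique ⟨?_, ?_⟩ <;> simp [hx.eq_zero, hy.eq_zero]
      · have hx' : HasTopCoeff x n _ := ⟨hx.natDegree_le_of_zero, rfl⟩
        have hy' : HasTopCoeff y n _ := ⟨hy.natDegree_le_of_zero, rfl⟩
        have := HasTopCoeff.succ_of_le (hx'.sq.add hy'.sq).X_mul.1
        rw [h.add_eq, show n + n + 1 + 1 = n + 1 + (n + 1) by lia] at this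
        exact (hz.sq.add hw.sq).unique this
    have hc : c = 0 := pow_eq_zero_iff two_ne_zero |>.mp (by linear_combination (hsum - hcd) / 2)
    have hd : d = 0 := pow_eq_zero_iff two_ne_zero |>.mp (by linear_combination (hsum + hcd) / 2)
    exact h0 ⟨rfl, rfl, hc, hd⟩
  · rintro rfl
    obtain rfl : d = 0 := by simpa using hcd
    have hdiff : a ^ 2 - b ^ 2 = 0 := by
      rcases n with _ | n
      · refine (hx.sq.sub hy.sq).unique (h.sub_eq ▸ ⟨?_, ?_⟩) <;> simp [hz.eq_zero, hw.eq_zero]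
      · have hz' : HasTopCoeff z n _ := ⟨hz.natDegree_le_of_zero, rfl⟩
        have hw' : HasTopCoeff w n _ := ⟨hw.natDegree_le_of_zero, rfl⟩
        have := HasTopCoeff.succ_of_le (hz'.sq.sub hw'.sq).X_mul.1
        rw [← h.sub_eq, show n + n + 1 + 1 = n + 1 + (n + 1) by lia] at this
        exact (hx.sq.sub hy.sq).unique this
    have ha : a = 0 := pow_eq_zero_iff two_ne_zero |>.mp (by linear_combination (hab + hdiff) / 2)
    have hb : b = 0 := pow_eq_zero_iff two_ne_zero |>.mp (by linear_combination (hab - hdiff) / 2)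
    exact h0 ⟨ha, hb, rfl, rfl⟩

theorem exists_topCoeff (h : IsPolynomialPoint x y z w) : ∃ (n : ℕ) (a b c d : ℂ),
    HasTopCoeff x n a ∧ HasTopCoeff y n b ∧ HasTopCoeff z n c ∧ HasTopCoeff w n d ∧
      ¬ (a = 0 ∧ b = 0 ∧ c = 0 ∧ d = 0) := by
  classical
  have hex : ∃ n, x.natDegree ≤ n ∧ y.natDegree ≤ n ∧ z.natDegree ≤ n ∧ w.natDegree ≤ n :=
    ⟨x.natDegree + y.natDegree + z.natDegree + w.natDegree, by lia⟩
  obtain ⟨n, ⟨hx, hy, hz, hw⟩, hmin⟩ := Nat.findX hex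
  refine ⟨n, _, _, _, _, ⟨hx, rfl⟩, ⟨hy, rfl⟩, ⟨hz, rfl⟩, ⟨hw, rfl⟩, ?_⟩
  rintro ⟨hx0, hy0, hz0, hw0⟩
  have hx' : HasTopCoeff x n 0 := ⟨hx, hx0⟩
  have hy' : HasTopCoeff y n 0 := ⟨hy, hy0⟩
  have hz' : HasTopCoeff z n 0 := ⟨hz, hz0⟩
  have hw' : HasTopCoeff w n 0 := ⟨hw, hw0⟩
  rcases n with _ | n
  · apply h.no_common_zero 0
    simp [hx'.eq_zero, hy'.eq_zero, hz'.eq_zero, hw'.eq_zero]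
  · exact hmin n n.lt_succ_self ⟨hx'.natDegree_le_of_zero, hy'.natDegree_le_of_zero,
      hz'.natDegree_le_of_zero, hw'.natDegree_le_of_zero⟩

end IsPolynomialPoint

/-- The sum of residues of `q / (X ^ 5 - X)` vanishes. -/
theorem HasTopCoeff.sum_eval_eq {q : ℂ[X]} {c : ℂ} (hq : HasTopCoeff q 4 c) :
    q.eval 1 + q.eval (-1) + q.eval Complex.I + q.eval (-Complex.I) = 4 * (q.eval 0 + c) := by
  have hlt : q.natDegree < 5 := Nat.lt_succ_of_le hq.1
  simp only [eval_eq_sum_range' hlt, Finset.sum_range_succ, Finset.sum_range_zero, hq.2]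
  linear_combination (2 * q.coeff 2 + 2 * c * (Complex.I ^ 2 - 1)) * Complex.I_sq

/-- The residues of the connection force the degree `n` of a point to satisfy `4 * n = 1`. -/
theorem not_isPolynomialPoint (x y z w : ℂ[X]) : ¬ IsPolynomialPoint x y z w := by
  intro h
  obtain ⟨p, q, hp1, hp2, hq⟩ := h.exists_connection
  obtain ⟨n, a, b, c, d, hx, hy, hz, hw, h0⟩ := h.exists_topCoeff
  obtain ⟨⟨ha, hc⟩, hba, hdc⟩ := h.topCoeff_ne_zero hx hy hz hw h0
  have htop : HasTopCoeff q 4 (8 * n - 3) := by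
    have hXsq : HasTopCoeff (1 + X ^ 2 : ℂ[X]) 2 1 := ⟨by compute_degree, by simp [coeff_one]⟩
    have hXsq' : HasTopCoeff (1 - X ^ 2 : ℂ[X]) 2 (-1) := ⟨by compute_degree, by simp [coeff_one]⟩
    have hXpow : HasTopCoeff (X ^ 4 - 1 : ℂ[X]) 4 1 := ⟨by compute_degree, by simp [coeff_one]⟩
    have hzp : HasTopCoeff (z * p) (n + (n + 2)) (b * d) := by
      have hwr := (hy.mul hw.X_mul_derivative).sub (hy.X_mul_derivative.mul hw)
      convert (hXsq.mul (hwr.C_mul 2)).sub (hXsq'.mul (hy.mul hw)) using 1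
      · rw [hp2, map_ofNat]
        ring
      · ring
      · ring
    obtain ⟨k, hp, hk⟩ := hz.exists_of_mul hc hzp
    have hksq : k ^ 2 = -a ^ 2 := mul_left_cancel₀ (pow_ne_zero 2 hc) (by
      linear_combination (c * k + b * d) * hk + d ^ 2 * hba - a ^ 2 * hdc)
    have hxq : HasTopCoeff (x ^ 2 * q) (n + n + 4) (a ^ 2 * (8 * n - 3)) := by
      have hlog := ((hx.mul hx.X_mul_derivative).C_mul 8).add (hy.sq.C_mul 4)
      have hpsq : HasTopCoeff (p ^ 2) (4 + (n + n)) (k ^ 2) := by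
        convert hp.sq using 1
        ring
      convert (hXpow.mul hlog).sub hpsq using 1
      · rw [hq, map_ofNat, map_ofNat]
      · ring
      · linear_combination -4 * hba + hksq
    obtain ⟨l, hql, hl⟩ := hx.sq.exists_of_mul (pow_ne_zero 2 ha) hxq
    exact mul_left_cancel₀ (pow_ne_zero 2 ha) hl ▸ hql
  have hzero : q.eval 0 = -3 := by
    have h1 := congrArg (eval 0) hp2
    have h2 := congrArg (eval 0) hq
    have h3 := h.eval_sub_eq 0
    have h4 := h.eval_add_eq 0
    obtain ⟨hx0, hz0⟩ := h.eval_zero_ne_zero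
    simp only [eval_add, eval_sub, eval_mul, eval_pow, eval_X, eval_ofNat, eval_one] at h1 h2
    apply mul_left_cancel₀ (mul_ne_zero (pow_ne_zero 2 hz0) (pow_ne_zero 2 hx0))
    linear_combination z.eval 0 ^ 2 * h2
      - (z.eval 0 * p.eval 0 - y.eval 0 * w.eval 0) * h1
      + (y.eval 0 ^ 2) * h4 + (3 * z.eval 0 ^ 2) * h3
  have hroot : ∀ e : ℂ, e ^ 4 = 1 → q.eval e = -4 := by
    intro e he
    have h1 := congrArg (eval e) hp1
    have h2 := congrArg (eval e) hq
    have hx0 := h.eval_root_of_unity_ne_zero he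
    have hy0 := h.swap.eval_root_of_unity_ne_zero he
    have hzw := h.eval_root_of_unity_sq_mul_sq he
    simp only [eval_add, eval_sub, eval_mul, eval_pow, eval_X, eval_ofNat, eval_one] at h1 h2
    rw [he] at h1 h2
    apply mul_left_cancel₀ (mul_ne_zero (pow_ne_zero 2 hy0) (pow_ne_zero 2 hx0))
    linear_combination y.eval e ^ 2 * h2
      - (y.eval e * p.eval e + 2 * e * z.eval e * w.eval e) * h1
      - 4 * e ^ 2 * hzw - 4 * x.eval e ^ 2 * y.eval e ^ 2 * he
  have hsum := htop.sum_eval_eq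
  rw [hroot 1 (by norm_num), hroot (-1) (by norm_num), hroot Complex.I Complex.I_pow_four,
    hroot (-Complex.I) (by rw [neg_pow, Complex.I_pow_four]; norm_num), hzero] at hsum
  have : ((4 * n : ℕ) : ℂ) = (1 : ℕ) := by
    push_cast
    linear_combination -hsum / 8
  have := Nat.cast_injective this
  lia

/-- The generic fibre `C : x² − y² = t(z² − w²), t(x² + y²) = z² + w²` of the elliptic
fibration of the diagonal quartic `x⁴ − y⁴ = z⁴ − w⁴` has no `ℂ(t)`-rational point. -/
theorem stmt9 : ¬ ∃ x y z w : RatFunc ℂ,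
    (x ≠ 0 ∨ y ≠ 0 ∨ z ≠ 0 ∨ w ≠ 0) ∧
    x ^ 2 - y ^ 2 = RatFunc.X * (z ^ 2 - w ^ 2) ∧
    RatFunc.X * (x ^ 2 + y ^ 2) = z ^ 2 + w ^ 2 := by
  rintro ⟨x, y, z, w, h0, h1, h2⟩
  obtain ⟨⟨b, hb⟩, hint⟩ :=
    IsLocalization.exist_integer_multiples (nonZeroDivisors ℂ[X]) Finset.univ ![x, y, z, w]
  have hb0 : algebraMap ℂ[X] (RatFunc ℂ) b ≠ 0 :=
    IsFractionRing.to_map_ne_zero_of_mem_nonZeroDivisors hb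
  have hinj := IsFractionRing.injective ℂ[X] (RatFunc ℂ)
  simp only [Algebra.smul_def] at hint
  obtain ⟨x', hx : algebraMap _ _ x' = _ * x⟩ := hint 0 (Finset.mem_univ _)
  obtain ⟨y', hy : algebraMap _ _ y' = _ * y⟩ := hint 1 (Finset.mem_univ _)
  obtain ⟨z', hz : algebraMap _ _ z' = _ * z⟩ := hint 2 (Finset.mem_univ _)
  obtain ⟨w', hw : algebraMap _ _ w' = _ * w⟩ := hint 3 (Finset.mem_univ _)
  have hne : ∀ {f : RatFunc ℂ} {f' : ℂ[X]}, algebraMap ℂ[X] (RatFunc ℂ) f' = algebraMap _ _ b * f →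
      f ≠ 0 → f' ≠ 0 := by
    rintro f _ hf hf0 rfl
    exact mul_ne_zero hb0 hf0 (by rw [← hf, map_zero])
  obtain ⟨x, y, z, w, h⟩ := IsPolynomialPoint.exists_of_ne_zero (x := x') (y := y') (z := z')
    (w := w') (h0.imp (hne hx) <| Or.imp (hne hy) <| Or.imp (hne hz) (hne hw))
    (hinj <| by
      simp only [map_sub, map_mul, map_pow, hx, hy, hz, hw, RatFunc.algebraMap_X]
      linear_combination (algebraMap ℂ[X] (RatFunc ℂ) b) ^ 2 * h1)
    (hinj <| by
      simp only [map_add, map_mul, map_pow, hx, hy, hz, hw, RatFunc.algebraMap_X]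
      linear_combination (algebraMap ℂ[X] (RatFunc ℂ) b) ^ 2 * h2)
  exact not_isPolynomialPoint x y z w h
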